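/- Let Φ : Set (ℝ × (ℕ → ℤ)) → Set (ℝ × (ℕ → ℤ)) be the monotone operator Φ(R) = {(x, p) | |x| ≤ 1 ∧ p 0 ∈ {-1, 0, 1} ∧ (2*x - (p 0 : ℝ), fun n => p (n+1)) ∈ R}. Then the greatest fixed point of Φ equals the set {(x, p) | (∀ n, p n ∈ {-1, 0, 1}) ∧ x = ∑' n, (p n : ℝ) / 2^(n+1)}. (This is the paper's claim that the realizers of the coinductive predicate S(x) are exactly the signed digit representations of x.) -/

import Mathlib

def PhiSreal : Set (ℝ × (ℕ → ℤ)) →o Set (ℝ × (ℕ → ℤ)) :=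
  ⟨fun R => {q | |q.1| ≤ 1 ∧ q.2 0 ∈ ({-1, 0, 1} : Set ℤ) ∧
      (2 * q.1 - (q.2 0 : ℝ), fun n => q.2 (n + 1)) ∈ R},
   fun R S h q hq => ⟨hq.1, hq.2.1, h hq.2.2⟩⟩

theorem hasSum_one_div_two_pow_succ : HasSum (fun n : ℕ => (1 : ℝ) / 2 ^ (n + 1)) 1 := by
  convert hasSum_geometric_two' 1 using 2 with n
  rw [pow_succ']
  field_simp

theorem norm_signed_digit_div_le {d : ℤ} (hd : d ∈ ({-1, 0, 1} : Set ℤ)) (n : ℕ) :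
    ‖(d : ℝ) / 2 ^ (n + 1)‖ ≤ 1 / 2 ^ (n + 1) := by
  rw [norm_div, norm_pow, Real.norm_ofNat]
  gcongr
  rcases hd with rfl | rfl | rfl <;> simp

theorem summable_signed_digits {p : ℕ → ℤ} (hp : ∀ n, p n ∈ ({-1, 0, 1} : Set ℤ)) :
    Summable fun n : ℕ => (p n : ℝ) / 2 ^ (n + 1) :=
  hasSum_one_div_two_pow_succ.summable.of_norm_bounded fun n => norm_signed_digit_div_le (hp n) n

theorem mem_gfp_PhiSreal_iff {x : ℝ} {p : ℕ → ℤ} :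
    (x, p) ∈ OrderHom.gfp PhiSreal ↔ |x| ≤ 1 ∧ p 0 ∈ ({-1, 0, 1} : Set ℤ) ∧
      (2 * x - (p 0 : ℝ), fun n => p (n + 1)) ∈ OrderHom.gfp PhiSreal := by
  conv_lhs => rw [← OrderHom.map_gfp PhiSreal]
  rfl

theorem digit_mem_of_mem_gfp_PhiSreal (n : ℕ) {x : ℝ} {p : ℕ → ℤ}
    (h : (x, p) ∈ OrderHom.gfp PhiSreal) : p n ∈ ({-1, 0, 1} : Set ℤ) := by
  induction n generalizing x p with
  | zero => exact (mem_gfp_PhiSreal_iff.1 h).2.1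
  | succ n ih => exact ih (mem_gfp_PhiSreal_iff.1 h).2.2

theorem abs_sub_partial_sum_le_of_mem_gfp_PhiSreal (n : ℕ) {x : ℝ} {p : ℕ → ℤ}
    (h : (x, p) ∈ OrderHom.gfp PhiSreal) :
    |x - ∑ i ∈ Finset.range n, (p i : ℝ) / 2 ^ (i + 1)| ≤ (1 / 2) ^ n := by
  induction n generalizing x p with
  | zero => simpa using (mem_gfp_PhiSreal_iff.1 h).1
  | succ n ih =>
    have hx : x - ∑ i ∈ Finset.range (n + 1), (p i : ℝ) / 2 ^ (i + 1) =
        1 / 2 * (2 * x - p 0 - ∑ i ∈ Finset.range n, (p (i + 1) : ℝ) / 2 ^ (i + 1)) := by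
      have hshift (i : ℕ) : (p (i + 1) : ℝ) / 2 ^ (i + 1 + 1) =
          1 / 2 * ((p (i + 1) : ℝ) / 2 ^ (i + 1)) := by
        rw [pow_succ _ (i + 1)]
        field_simp
      simp only [Finset.sum_range_succ', hshift, ← Finset.mul_sum]
      ring
    rw [hx, abs_mul, abs_of_pos one_half_pos, pow_succ']
    gcongr
    exact ih (mem_gfp_PhiSreal_iff.1 h).2.2

theorem gfp_PhiSreal_eq_signed_digit_representations :
    OrderHom.gfp PhiSreal =
      {q : ℝ × (ℕ → ℤ) | (∀ n, q.2 n ∈ ({-1, 0, 1} : Set ℤ)) ∧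
        q.1 = ∑' n : ℕ, (q.2 n : ℝ) / 2 ^ (n + 1)} := by
  apply le_antisymm
  · rintro ⟨x, p⟩ h
    have hp n := digit_mem_of_mem_gfp_PhiSreal n h
    refine ⟨hp, tendsto_nhds_unique ?_ (summable_signed_digits hp).hasSum.tendsto_sum_nat⟩
    rw [tendsto_iff_dist_tendsto_zero]
    refine squeeze_zero (fun _ => dist_nonneg) (fun n => ?_)
      (tendsto_pow_atTop_nhds_zero_of_lt_one one_half_pos.le (one_half_lt_one (α := ℝ)))
    rw [dist_comm, Real.dist_eq]
    exact abs_sub_partial_sum_le_of_mem_gfp_PhiSreal n h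
  · apply OrderHom.le_gfp
    rintro ⟨x, p⟩ ⟨hp, hx⟩
    dsimp only at hp hx
    refine ⟨?_, hp 0, fun n => hp (n + 1), ?_⟩
    · rw [hx]
      exact tsum_of_norm_bounded hasSum_one_div_two_pow_succ
        fun n => norm_signed_digit_div_le (hp n) n
    · dsimp only
      rw [hx, (summable_signed_digits hp).tsum_eq_zero_add, mul_add, ← tsum_mul_left]
      have hshift (n : ℕ) : 2 * ((p (n + 1) : ℝ) / 2 ^ (n + 1 + 1)) =
          (p (n + 1) : ℝ) / 2 ^ (n + 1) := by
        rw [pow_succ _ (n + 1)]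
        field_simp
      simp only [hshift]
      ring
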